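/- For every x ∈ Σ'_ι[λ], the element x* is extremal. -/

import Mathlib

open Filter Function

namespace HypCrystal

variable (a1 a2 k1 k2 : ℤ)

/-- `i_k`: 1 if `k` is odd, 2 if `k` is even. -/
def idx (k : ℤ) : ℤ := if k % 2 = 1 then 1 else 2

/-- membership in the index set `I = {1,2}`. -/
def IsI (i : ℤ) : Prop := i = 1 ∨ i = 2

/-- `⟨α_{i_j}, α_{i_k}^∨⟩`. -/
def pairJK (j k : ℤ) : ℤ :=
  if j % 2 = k % 2 then 2 else if k % 2 = 1 then -a1 else -a2

/-- `⟨α_{i_j}, α_i^∨⟩` for `i ∈ {1,2}`. -/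
def pairJI (j i : ℤ) : ℤ :=
  if idx j = i then 2 else if i = 1 then -a1 else -a2

/-- `α_{i_j}` in the `(Λ1, Λ2)`-coordinates. -/
def alphaOf (j : ℤ) : ℤ × ℤ := if j % 2 = 1 then (2, -a2) else (-a1, 2)

/-- `⟨ν, α_i^∨⟩` for a weight `ν` in `(Λ1, Λ2)`-coordinates. -/
def pairW (ν : ℤ × ℤ) (i : ℤ) : ℤ := if i = 1 then ν.1 else ν.2

/-- the sequence `c_j`. -/
def cseq : ℕ → ℤ
  | 0 => 0
  | 1 => 1
  | j + 2 => (if j % 2 = 0 then a1 else a2) * cseq (j + 1) - cseq j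

/-- the sequence `c'_j`. -/
def cseq' : ℕ → ℤ
  | 0 => 0
  | 1 => 1
  | j + 2 => (if j % 2 = 0 then a2 else a1) * cseq' (j + 1) - cseq' j

noncomputable def alphaR : ℝ :=
  ((a1 : ℝ) * a2 + Real.sqrt ((a1 : ℝ) ^ 2 * (a2 : ℝ) ^ 2 - 4 * a1 * a2)) / (2 * a2)

noncomputable def betaR : ℝ :=
  ((a1 : ℝ) * a2 + Real.sqrt ((a1 : ℝ) ^ 2 * (a2 : ℝ) ^ 2 - 4 * a1 * a2)) / (2 * a1)

/-- `γ_k = α` if `k` even, `β` if `k` odd. -/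
noncomputable def gammaR (k : ℤ) : ℝ := if k % 2 = 0 then alphaR a1 a2 else betaR a1 a2

/-- `p_m` for `m ≥ 0`. -/
def ppos : ℕ → ℤ
  | 0 => k2
  | 1 => k1
  | m + 2 => (if m % 2 = 0 then a2 else a1) * ppos (m + 1) - ppos m

/-- `p_{-n}` for `n ≥ 0`. -/
def pneg : ℕ → ℤ
  | 0 => k2
  | 1 => a1 * k2 - k1
  | n + 2 => (if (n + 2) % 2 = 0 then a2 else a1) * pneg (n + 1) - pneg n

/-- the two-sided sequence `p_m`, `m ∈ ℤ`, with `p_0 = k2`, `p_1 = k1`. -/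
def pseq (m : ℤ) : ℤ :=
  if 0 ≤ m then ppos a1 a2 k1 k2 m.toNat else pneg a1 a2 k1 k2 (-m).toNat

/-- `λ = k1·Λ1 − k2·Λ2` in `(Λ1, Λ2)`-coordinates. -/
def lamW : ℤ × ℤ := (k1, -k2)

/-- membership in `ℤ^{+∞}` (coordinates supported on positions `≥ 1`, nonnegative,
finitely supported). -/
def ZPlusMem (x : ℤ → ℤ) : Prop :=
  (∀ k : ℤ, k ≤ 0 → x k = 0) ∧ (∀ k : ℤ, 0 ≤ x k) ∧ ∃ N : ℕ, ∀ k : ℤ, (N : ℤ) < k → x k = 0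

/-- membership in `ℤ^{−∞}` (coordinates supported on positions `≤ 0`, nonpositive,
finitely supported). -/
def ZMinusMem (x : ℤ → ℤ) : Prop :=
  (∀ k : ℤ, 1 ≤ k → x k = 0) ∧ (∀ k : ℤ, x k ≤ 0) ∧ ∃ N : ℕ, ∀ k : ℤ, k < -(N : ℤ) → x k = 0

/-- membership in `X+ = Img(Ψ⁺)`. -/
def XPlusMem (x : ℤ → ℤ) : Prop :=
  ZPlusMem x ∧ ∀ j : ℤ, 1 ≤ j →
    0 ≤ cseq a1 a2 j.toNat * x j - cseq a1 a2 (j - 1).toNat * x (j + 1)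

/-- membership in `X− = Img(Ψ⁻)`. -/
def XMinusMem (x : ℤ → ℤ) : Prop :=
  ZMinusMem x ∧ ∀ j : ℤ, j ≤ 0 →
    cseq' a1 a2 (1 - j).toNat * x j - cseq' a1 a2 (-j).toNat * x (j - 1) ≤ 0

def posPart (x : ℤ → ℤ) : ℤ → ℤ := fun k => if 1 ≤ k then x k else 0
def negPart (x : ℤ → ℤ) : ℤ → ℤ := fun k => if k ≤ 0 then x k else 0

/-- membership in `Z_ι(μ) = ℤ^{+∞} ⊗ t_μ ⊗ ℤ^{−∞}` (in coordinates). -/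
def ZMem (x : ℤ → ℤ) : Prop := ZPlusMem (posPart x) ∧ ZMinusMem (negPart x)

/-- membership in `X+ ⊗ t_λ ⊗ X−` (in coordinates). -/
def XXMem (x : ℤ → ℤ) : Prop := XPlusMem a1 a2 (posPart x) ∧ XMinusMem a1 a2 (negPart x)

/-- `σ_k` on `ℤ^{+∞}` (for `k ≥ 1`). -/
noncomputable def sigmaP (x : ℤ → ℤ) (k : ℤ) : ℤ :=
  x k + ∑ᶠ j : ℤ, if k < j then pairJK a1 a2 j k * x j else 0

/-- `σ_k` on `ℤ^{−∞}` (for `k ≤ 0`). -/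
noncomputable def sigmaM (x : ℤ → ℤ) (k : ℤ) : ℤ :=
  -(x k) - ∑ᶠ j : ℤ, if j < k then pairJK a1 a2 j k * x j else 0

/-- `−Σ_j x_j α_{i_j}` in `(Λ1, Λ2)`-coordinates. -/
noncomputable def wtOf (x : ℤ → ℤ) : ℤ × ℤ :=
  (-∑ᶠ j : ℤ, x j * (alphaOf a1 a2 j).1, -∑ᶠ j : ℤ, x j * (alphaOf a1 a2 j).2)

/-- `wt(x) = μ − Σ_j x_j α_{i_j}`. -/
noncomputable def wtZ (μ : ℤ × ℤ) (x : ℤ → ℤ) : ℤ × ℤ := μ + wtOf a1 a2 x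

/-- `σ_k` on `Z_ι(μ)`. -/
noncomputable def sigmaZ (μ : ℤ × ℤ) (x : ℤ → ℤ) (k : ℤ) : ℤ :=
  if 1 ≤ k then sigmaP a1 a2 x k
  else sigmaM a1 a2 x k - pairW (wtZ a1 a2 μ x) (idx k)

/-- `ε_i` on `Z_ι(μ)`. -/
noncomputable def epsZ (μ : ℤ × ℤ) (x : ℤ → ℤ) (i : ℤ) : ℤ :=
  sSup {s : ℤ | ∃ k : ℤ, idx k = i ∧ sigmaZ a1 a2 μ x k = s}

/-- `φ_i` on `Z_ι(μ)`. -/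
noncomputable def phiZ (μ : ℤ × ℤ) (x : ℤ → ℤ) (i : ℤ) : ℤ :=
  epsZ a1 a2 μ x i + pairW (wtZ a1 a2 μ x) i

noncomputable def kmaxZ (μ : ℤ × ℤ) (x : ℤ → ℤ) (i : ℤ) : ℤ :=
  sSup {k : ℤ | idx k = i ∧ sigmaZ a1 a2 μ x k = epsZ a1 a2 μ x i}

noncomputable def kminZ (μ : ℤ × ℤ) (x : ℤ → ℤ) (i : ℤ) : ℤ :=
  sInf {k : ℤ | idx k = i ∧ sigmaZ a1 a2 μ x k = epsZ a1 a2 μ x i}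

/-- `ẽ_i` on `Z_ι(μ)`; `none` represents `0`. -/
noncomputable def eZ (μ : ℤ × ℤ) (i : ℤ) (x : ℤ → ℤ) : Option (ℤ → ℤ) :=
  if 0 < epsZ a1 a2 μ x i then
    some (Function.update x (kmaxZ a1 a2 μ x i) (x (kmaxZ a1 a2 μ x i) - 1))
  else none

/-- `f̃_i` on `Z_ι(μ)`; `none` represents `0`. -/
noncomputable def fZ (μ : ℤ × ℤ) (i : ℤ) (x : ℤ → ℤ) : Option (ℤ → ℤ) :=
  if 0 < phiZ a1 a2 μ x i then
    some (Function.update x (kminZ a1 a2 μ x i) (x (kminZ a1 a2 μ x i) + 1))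
  else none

/-- `ε_i` on `ℤ^{+∞}`. -/
noncomputable def epsP (x : ℤ → ℤ) (i : ℤ) : ℤ :=
  sSup {s : ℤ | ∃ k : ℤ, 1 ≤ k ∧ idx k = i ∧ sigmaP a1 a2 x k = s}

noncomputable def kmaxP (x : ℤ → ℤ) (i : ℤ) : ℤ :=
  sSup {k : ℤ | 1 ≤ k ∧ idx k = i ∧ sigmaP a1 a2 x k = epsP a1 a2 x i}

noncomputable def kminP (x : ℤ → ℤ) (i : ℤ) : ℤ :=
  sInf {k : ℤ | 1 ≤ k ∧ idx k = i ∧ sigmaP a1 a2 x k = epsP a1 a2 x i}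

/-- `ẽ_i` on `ℤ^{+∞}` (partial). -/
noncomputable def eP (i : ℤ) (x : ℤ → ℤ) : Option (ℤ → ℤ) :=
  if 0 < epsP a1 a2 x i then
    some (Function.update x (kmaxP a1 a2 x i) (x (kmaxP a1 a2 x i) - 1))
  else none

/-- `f̃_i` on `ℤ^{+∞}` (total). -/
noncomputable def fP (i : ℤ) (x : ℤ → ℤ) : ℤ → ℤ :=
  Function.update x (kminP a1 a2 x i) (x (kminP a1 a2 x i) + 1)

/-- `φ_i` on `ℤ^{−∞}`. -/
noncomputable def phiMf (x : ℤ → ℤ) (i : ℤ) : ℤ :=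
  sSup {s : ℤ | ∃ k : ℤ, k ≤ 0 ∧ idx k = i ∧ sigmaM a1 a2 x k = s}

noncomputable def kmaxM (x : ℤ → ℤ) (i : ℤ) : ℤ :=
  sSup {k : ℤ | k ≤ 0 ∧ idx k = i ∧ sigmaM a1 a2 x k = phiMf a1 a2 x i}

noncomputable def kminM (x : ℤ → ℤ) (i : ℤ) : ℤ :=
  sInf {k : ℤ | k ≤ 0 ∧ idx k = i ∧ sigmaM a1 a2 x k = phiMf a1 a2 x i}

/-- `ẽ_i` on `ℤ^{−∞}` (total). -/
noncomputable def eM (i : ℤ) (x : ℤ → ℤ) : ℤ → ℤ :=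
  Function.update x (kmaxM a1 a2 x i) (x (kmaxM a1 a2 x i) - 1)

noncomputable def fPiter (i : ℤ) (n : ℕ) (x : ℤ → ℤ) : ℤ → ℤ := (fP a1 a2 i)^[n] x

noncomputable def eMiter (i : ℤ) (n : ℕ) (x : ℤ → ℤ) : ℤ → ℤ := (eM a1 a2 i)^[n] x

noncomputable def ePiterO (i : ℤ) (n : ℕ) (ox : Option (ℤ → ℤ)) : Option (ℤ → ℤ) :=
  (fun o => o.bind (eP a1 a2 i))^[n] ox

noncomputable def eZiterO (μ : ℤ × ℤ) (i : ℤ) (n : ℕ) (ox : Option (ℤ → ℤ)) : Option (ℤ → ℤ) :=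
  (fun o => o.bind (eZ a1 a2 μ i))^[n] ox

noncomputable def fZiterO (μ : ℤ × ℤ) (i : ℤ) (n : ℕ) (ox : Option (ℤ → ℤ)) : Option (ℤ → ℤ) :=
  (fun o => o.bind (fZ a1 a2 μ i))^[n] ox

noncomputable def suppBoundP (x : ℤ → ℤ) : ℕ := sInf {N : ℕ | ∀ k : ℤ, (N : ℤ) < k → x k = 0}

noncomputable def suppBoundM (x : ℤ → ℤ) : ℕ := sInf {N : ℕ | ∀ k : ℤ, k < -(N : ℤ) → x k = 0}

/-- `starPChain x n z = f̃_{i_1}^{x_1} ⋯ f̃_{i_n}^{x_n} (z)` on `ℤ^{+∞}`. -/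
noncomputable def starPChain (x : ℤ → ℤ) : ℕ → (ℤ → ℤ) → (ℤ → ℤ)
  | 0, z => z
  | n + 1, z => starPChain x n (fPiter a1 a2 (idx ((n : ℤ) + 1)) ((x ((n : ℤ) + 1)).toNat) z)

/-- the `∗`-operation on `X+`: `(x⁺)* = f̃_{i_1}^{x_1} ⋯ f̃_{i_N}^{x_N} (z_∞)`. -/
noncomputable def starP (x : ℤ → ℤ) : ℤ → ℤ :=
  starPChain a1 a2 x (suppBoundP x) (fun _ => 0)

/-- `starMChain x n z = ẽ_{i_0}^{−x_0} ⋯ ẽ_{i_{-(n-1)}}^{−x_{-(n-1)}} (z)` on `ℤ^{−∞}`. -/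
noncomputable def starMChain (x : ℤ → ℤ) : ℕ → (ℤ → ℤ) → (ℤ → ℤ)
  | 0, z => z
  | n + 1, z => starMChain x n (eMiter a1 a2 (idx (-(n : ℤ))) ((-(x (-(n : ℤ)))).toNat) z)

/-- the `∗`-operation on `X−`. -/
noncomputable def starM (x : ℤ → ℤ) : ℤ → ℤ :=
  starMChain a1 a2 x (suppBoundM x + 1) (fun _ => 0)

/-- combine a `ℤ^{+∞}`- and a `ℤ^{−∞}`-component into an element of `Z_ι(μ)`. -/
def combine (y z : ℤ → ℤ) : ℤ → ℤ := fun k => if 1 ≤ k then y k else z k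

/-- the coordinates of `x* = (x⁺)* ⊗ t_μ ⊗ (x⁻)*`. -/
noncomputable def xstarFun (x : ℤ → ℤ) : ℤ → ℤ :=
  combine (starP a1 a2 (posPart x)) (starM a1 a2 (negPart x))

/-- the weight `μ = −λ − wt(x⁺) − wt(x⁻)` of `x*`. -/
noncomputable def mustar (lam : ℤ × ℤ) (x : ℤ → ℤ) : ℤ × ℤ :=
  -lam - wtOf a1 a2 (posPart x) - wtOf a1 a2 (negPart x)

/-- `fPnegChain g n z = f̃_{i_{-(n-1)}}^{g(-(n-1))} ⋯ f̃_{i_{-1}}^{g(-1)} f̃_{i_0}^{g 0} (z)`. -/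
noncomputable def fPnegChain (g : ℤ → ℕ) : ℕ → (ℤ → ℤ) → (ℤ → ℤ)
  | 0, z => z
  | n + 1, z => fPiter a1 a2 (idx (-(n : ℤ))) (g (-(n : ℤ))) (fPnegChain g n z)

/-- `eMposChain g n z = ẽ_{i_n}^{g n} ⋯ ẽ_{i_2}^{g 2} ẽ_{i_1}^{g 1} (z)`. -/
noncomputable def eMposChain (g : ℤ → ℕ) : ℕ → (ℤ → ℤ) → (ℤ → ℤ)
  | 0, z => z
  | n + 1, z => eMiter a1 a2 (idx ((n : ℤ) + 1)) (g ((n : ℤ) + 1)) (eMposChain g n z)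

/-- `ePposChainO g n z = ẽ_{i_n}^{g n} ⋯ ẽ_{i_2}^{g 2} ẽ_{i_1}^{g 1} (z)` on `ℤ^{+∞}`. -/
noncomputable def ePposChainO (g : ℤ → ℕ) : ℕ → Option (ℤ → ℤ) → Option (ℤ → ℤ)
  | 0, z => z
  | n + 1, z => ePiterO a1 a2 (idx ((n : ℤ) + 1)) (g ((n : ℤ) + 1)) (ePposChainO g n z)

/-- the Weyl group action `S_i` on `Z_ι(μ) ∪ {0}`. -/
noncomputable def SiO (μ : ℤ × ℤ) (i : ℤ) (ob : Option (ℤ → ℤ)) : Option (ℤ → ℤ) :=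
  ob.bind fun b =>
    if 0 ≤ pairW (wtZ a1 a2 μ b) i then
      fZiterO a1 a2 μ i (pairW (wtZ a1 a2 μ b) i).toNat (some b)
    else eZiterO a1 a2 μ i (-(pairW (wtZ a1 a2 μ b) i)).toNat (some b)

/-- `SwPos μ n = S_{i_n} ⋯ S_{i_2} S_{i_1}`. -/
noncomputable def SwPos (μ : ℤ × ℤ) : ℕ → Option (ℤ → ℤ) → Option (ℤ → ℤ)
  | 0, b => b
  | n + 1, b => SiO a1 a2 μ (idx ((n : ℤ) + 1)) (SwPos μ n b)

/-- `SwNeg μ n = S_{i_{-(n-1)}} ⋯ S_{i_{-1}} S_{i_0}`. -/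
noncomputable def SwNeg (μ : ℤ × ℤ) : ℕ → Option (ℤ → ℤ) → Option (ℤ → ℤ)
  | 0, b => b
  | n + 1, b => SiO a1 a2 μ (idx (-(n : ℤ))) (SwNeg μ n b)

/-- `S_{w_k}`. -/
noncomputable def Swk (μ : ℤ × ℤ) (k : ℤ) (b : Option (ℤ → ℤ)) : Option (ℤ → ℤ) :=
  if 0 ≤ k then SwPos a1 a2 μ k.toNat b else SwNeg a1 a2 μ (-k).toNat b

/-- `b ∈ Z_ι(μ)` is extremal. -/
noncomputable def Extremal (μ : ℤ × ℤ) (b : ℤ → ℤ) : Prop :=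
  ∀ js : List ℤ, (∀ j ∈ js, IsI j) →
    ∃ b', js.foldr (SiO a1 a2 μ) (some b) = some b' ∧
      ∀ i : ℤ, IsI i →
        (0 ≤ pairW (wtZ a1 a2 μ b') i → eZ a1 a2 μ i b' = none) ∧
        (pairW (wtZ a1 a2 μ b') i ≤ 0 → fZ a1 a2 μ i b' = none)

/-- `φ(x) ≥ 0` for all `φ ∈ Ξ_ι[λ]`. -/
noncomputable def SigmaCond (x : ℤ → ℤ) : Prop :=
  (0 ≤ gammaR a1 a2 0 * (pseq a1 a2 k1 k2 0 : ℝ) + gammaR a1 a2 0 * (x 0 : ℝ) - (x 1 : ℝ)) ∧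
  (0 ≤ gammaR a1 a2 1 * (pseq a1 a2 k1 k2 1 : ℝ) + (x 0 : ℝ) - gammaR a1 a2 1 * (x 1 : ℝ)) ∧
  (∀ k : ℤ, 1 ≤ k → 0 ≤ (pseq a1 a2 k1 k2 k : ℝ) - (x k : ℝ)) ∧
  (∀ k : ℤ, 1 ≤ k → 0 ≤ gammaR a1 a2 k * (x k : ℝ) - (x (k + 1) : ℝ)) ∧
  (∀ k : ℤ, 1 ≤ k → 0 ≤ gammaR a1 a2 (k + 1) * (pseq a1 a2 k1 k2 (k + 1) : ℝ) -
      (pseq a1 a2 k1 k2 k : ℝ) + (x k : ℝ) - gammaR a1 a2 (k + 1) * (x (k + 1) : ℝ)) ∧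
  (∀ k : ℤ, k ≤ 0 → 0 ≤ (pseq a1 a2 k1 k2 k : ℝ) + (x k : ℝ)) ∧
  (∀ k : ℤ, k ≤ 0 → 0 ≤ (x (k - 1) : ℝ) - gammaR a1 a2 k * (x k : ℝ)) ∧
  (∀ k : ℤ, k ≤ 0 → 0 ≤ gammaR a1 a2 (k - 1) * (pseq a1 a2 k1 k2 (k - 1) : ℝ) -
      (pseq a1 a2 k1 k2 k : ℝ) + gammaR a1 a2 (k - 1) * (x (k - 1) : ℝ) - (x k : ℝ))

/-- membership in `Σ_ι[λ]`. -/
noncomputable def SigmaMem (x : ℤ → ℤ) : Prop :=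
  ZMem x ∧ SigmaCond a1 a2 k1 k2 x

/-- membership in `Σ'_ι[λ]`. -/
noncomputable def SigmaPrimeMem (x : ℤ → ℤ) : Prop :=
  SigmaMem a1 a2 k1 k2 x ∧ (∀ k : ℤ, k ≤ 0 → x k = 0) ∧ XPlusMem a1 a2 (posPart x)

/-- evaluation of an affine function `φ = (c, (φ_l)_l)` at `x`. -/
noncomputable def evalAff (φ : ℝ × (ℤ → ℝ)) (x : ℤ → ℤ) : ℝ :=
  φ.1 + ∑ᶠ l : ℤ, φ.2 l * (x l : ℝ)

/-- `a_{i_k}`. -/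
def aIdx (k : ℤ) : ℤ := if k % 2 = 1 then a1 else a2

/-- the affine function `b̄_k`. -/
noncomputable def bbar (lam : ℤ × ℤ) (k : ℤ) : ℝ × (ℤ → ℝ) :=
  ((if k = -1 ∨ k = 0 then -(pairW lam (idx k) : ℝ) else 0),
    fun l => (if l = k then (1 : ℝ) else 0) + (if l = k + 1 then -(aIdx a1 a2 k : ℝ) else 0) +
      (if l = k + 2 then (1 : ℝ) else 0))

/-- the operator `S̄_k` on affine functions. -/
noncomputable def SbarOp (lam : ℤ × ℤ) (k : ℤ) (φ : ℝ × (ℤ → ℝ)) : ℝ × (ℤ → ℝ) :=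
  let b := if 0 ≤ φ.2 k then bbar a1 a2 lam (k + 2) else bbar a1 a2 lam (k - 2)
  (φ.1 - φ.2 k * b.1, fun l => φ.2 l - φ.2 k * b.2 l)

end HypCrystal

namespace HypCrystal

theorem idx_eq_idx_iff {k n : ℤ} : idx k = idx n ↔ k % 2 = n % 2 := by
  unfold idx
  split_ifs <;> simp <;> omega

theorem finsum_sub_succ (S : ℤ → ℤ) {p q K L : ℤ} (hK : ∀ k ≤ K, S k = p)
    (hL : ∀ k, L ≤ k → S k = q) : ∑ᶠ j, (S j - S (j + 1)) = p - q := by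
  have telescope : ∀ M, K ≤ M → ∑ j ∈ Finset.Ico K M, (S j - S (j + 1)) = S K - S M := by
    intro M hM
    induction M, hM using Int.leInduction with
    | base => simp
    | succ M hM ih =>
      have hins : Finset.Ico K (M + 1) = insert M (Finset.Ico K M) := by
        ext j
        simp only [Finset.mem_Ico, Finset.mem_insert]
        omega
      rw [hins, Finset.sum_insert (by simp), ih]
      ring
  rw [finsum_eq_sum_of_support_subset (s := Finset.Ico K (max K L)), telescope _ (le_max_left _ _),
    hK K le_rfl, hL _ (le_max_right _ _)]
  intro j hj
  rw [Function.mem_support] at hj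
  rw [Finset.coe_Ico, Set.mem_Ico]
  by_contra hcon
  apply hj
  rcases lt_or_ge j K with h | h
  · rw [hK j (by omega), hK (j + 1) (by omega), sub_self]
  · have : max K L ≤ j := by
      by_contra h'
      exact hcon ⟨h, not_le.mp h'⟩
    have := le_trans (le_max_right K L) this
    rw [hL j (by omega), hL (j + 1) (by omega), sub_self]

/-- A profile of total height `p` descends from `p` to `0` and drops only at positions of the
parity of `n`. It records how the factors of `f̃_{i_n}^p` are distributed over the positions. -/
structure IsProfile (n p : ℤ) (S : ℤ → ℤ) : Prop where
  low : ∃ K, ∀ k ≤ K, S k = p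
  high : ∃ L, ∀ k, L ≤ k → S k = 0
  anti : ∀ k, S (k + 1) ≤ S k
  const : ∀ k, k % 2 ≠ n % 2 → S (k + 1) = S k

/-- The sequence obtained from `b` by adding the drops of the profile `S`. -/
def bump (b S : ℤ → ℤ) : ℤ → ℤ := fun k => b k + (S k - S (k + 1))

namespace IsProfile

variable {n p : ℤ} {S : ℤ → ℤ}

theorem antitone (hS : IsProfile n p S) : Antitone S := antitone_int_of_succ_le hS.anti

theorem nonneg (hS : IsProfile n p S) (k : ℤ) : 0 ≤ S k := by
  obtain ⟨L, hL⟩ := hS.high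
  rw [← hL (max k L) (le_max_right _ _)]
  exact hS.antitone (le_max_left _ _)

theorem le (hS : IsProfile n p S) (k : ℤ) : S k ≤ p := by
  obtain ⟨K, hK⟩ := hS.low
  rw [← hK (min k K) (min_le_right _ _)]
  exact hS.antitone (min_le_left _ _)

theorem inf (hS : IsProfile n p S) {s : ℤ} (h0 : 0 ≤ s) (hs : s ≤ p) :
    IsProfile n s (fun k => min s (S k)) where
  low := by
    obtain ⟨K, hK⟩ := hS.low
    exact ⟨K, fun k hk => by simp [hK k hk, hs]⟩
  high := by
    obtain ⟨L, hL⟩ := hS.high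
    exact ⟨L, fun k hk => by simp [hL k hk, h0]⟩
  anti k := min_le_min_left _ (hS.anti k)
  const k hk := by simp [hS.const k hk]

theorem support_finite (hS : IsProfile n p S) :
    (Function.support fun j => S j - S (j + 1)).Finite := by
  obtain ⟨K, hK⟩ := hS.low
  obtain ⟨L, hL⟩ := hS.high
  refine (Set.finite_Icc K L).subset fun j hj => ?_
  rw [Function.mem_support] at hj
  by_contra hcon
  apply hj
  rw [Set.mem_Icc] at hcon
  rcases lt_or_ge j K with h | h
  · rw [hK j (by omega), hK (j + 1) (by omega), sub_self]
  · rw [hL j (by omega), hL (j + 1) (by omega), sub_self]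

theorem weighted_finsum (hS : IsProfile n p S) {g : ℤ → ℤ} {G : ℤ}
    (hg : ∀ j, j % 2 = n % 2 → g j = G) : ∑ᶠ j, (S j - S (j + 1)) * g j = p * G := by
  obtain ⟨K, hK⟩ := hS.low
  obtain ⟨L, hL⟩ := hS.high
  have h : ∀ j, (S j - S (j + 1)) * g j = (S j * G) - (S (j + 1) * G) := by
    intro j
    by_cases hj : j % 2 = n % 2
    · rw [hg j hj]; ring
    · rw [hS.const j hj]; ring
  simp_rw [h]
  rw [finsum_sub_succ (fun j => S j * G) (p := p * G) (q := 0) (K := K) (L := L)]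
  · ring
  · intro k hk; simp [hK k hk]
  · intro k hk; simp [hL k hk]

theorem weighted_finsum_gt (hS : IsProfile n p S) {g : ℤ → ℤ} {G : ℤ}
    (hg : ∀ j, j % 2 = n % 2 → g j = G) (k : ℤ) :
    ∑ᶠ j, (if k < j then g j * (S j - S (j + 1)) else 0) = G * S (k + 1) := by
  obtain ⟨L, hL⟩ := hS.high
  have h : ∀ j, (if k < j then g j * (S j - S (j + 1)) else 0) =
      (G * S (max j (k + 1))) - (G * S (max (j + 1) (k + 1))) := by
    intro j
    split_ifs with hkj
    · rw [max_eq_left (by omega), max_eq_left (by omega)]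
      by_cases hj : j % 2 = n % 2
      · rw [hg j hj]; ring
      · rw [hS.const j hj]; ring
    · rw [max_eq_right (by omega), max_eq_right (by omega), sub_self]
  simp_rw [h]
  rw [finsum_sub_succ (fun j => G * S (max j (k + 1))) (p := G * S (k + 1)) (q := 0) (K := k + 1)
    (L := L)]
  · ring
  · intro j hj; rw [max_eq_right hj]
  · intro j hj; rw [hL _ (le_trans hj (le_max_left _ _)), mul_zero]

theorem weighted_finsum_lt (hS : IsProfile n p S) {g : ℤ → ℤ} {G : ℤ}
    (hg : ∀ j, j % 2 = n % 2 → g j = G) (k : ℤ) :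
    ∑ᶠ j, (if j < k then g j * (S j - S (j + 1)) else 0) = G * (p - S k) := by
  obtain ⟨K, hK⟩ := hS.low
  have h : ∀ j, (if j < k then g j * (S j - S (j + 1)) else 0) =
      (G * S (min j k)) - (G * S (min (j + 1) k)) := by
    intro j
    split_ifs with hkj
    · rw [min_eq_left (by omega), min_eq_left (by omega)]
      by_cases hj : j % 2 = n % 2
      · rw [hg j hj]; ring
      · rw [hS.const j hj]; ring
    · rw [min_eq_right (by omega), min_eq_right (by omega), sub_self]
  simp_rw [h]
  rw [finsum_sub_succ (fun j => G * S (min j k)) (p := G * p) (q := G * S k) (K := K)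
    (L := k)]
  · ring
  · intro j hj; rw [hK _ (le_trans (min_le_left _ _) hj)]
  · intro j hj; rw [min_eq_right hj]

end IsProfile

theorem finite_support_ite_mul {b : ℤ → ℤ} (hb : b.support.Finite) (P : ℤ → Prop)
    [DecidablePred P] (g : ℤ → ℤ) :
    (Function.support fun j => if P j then g j * b j else 0).Finite := by
  refine hb.subset fun j hj => ?_
  simp only [Function.mem_support, ne_eq, ite_eq_right_iff, mul_eq_zero, not_forall] at hj ⊢
  obtain ⟨-, h⟩ := hj
  exact fun h' => h (Or.inr h')

theorem finite_support_mul {b : ℤ → ℤ} (hb : b.support.Finite) (g : ℤ → ℤ) :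
    (Function.support fun j => b j * g j).Finite := by
  refine hb.subset fun j hj => ?_
  simp only [Function.mem_support, ne_eq, mul_eq_zero, not_or] at hj ⊢
  exact hj.1

section Bump

variable {n p : ℤ} {S b : ℤ → ℤ}

theorem finite_support_bump (hS : IsProfile n p S) (hb : b.support.Finite) :
    (bump b S).support.Finite :=
  (hb.union hS.support_finite).subset (Function.support_add b fun k => S k - S (k + 1))

theorem finsum_gt_bump (hS : IsProfile n p S) (hb : b.support.Finite) {g : ℤ → ℤ} {G : ℤ}
    (hg : ∀ j, j % 2 = n % 2 → g j = G) (k : ℤ) :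
    ∑ᶠ j, (if k < j then g j * bump b S j else 0) =
      ∑ᶠ j, (if k < j then g j * b j else 0) + G * S (k + 1) := by
  rw [← hS.weighted_finsum_gt hg, ← finsum_add_distrib (finite_support_ite_mul hb _ _)
    (finite_support_ite_mul hS.support_finite _ _)]
  refine finsum_congr fun j => ?_
  unfold bump
  split_ifs <;> ring

theorem finsum_lt_bump (hS : IsProfile n p S) (hb : b.support.Finite) {g : ℤ → ℤ} {G : ℤ}
    (hg : ∀ j, j % 2 = n % 2 → g j = G) (k : ℤ) :
    ∑ᶠ j, (if j < k then g j * bump b S j else 0) =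
      ∑ᶠ j, (if j < k then g j * b j else 0) + G * (p - S k) := by
  rw [← hS.weighted_finsum_lt hg, ← finsum_add_distrib (finite_support_ite_mul hb _ _)
    (finite_support_ite_mul hS.support_finite _ _)]
  refine finsum_congr fun j => ?_
  unfold bump
  split_ifs <;> ring

theorem sigmaP_bump_same (a1 a2 : ℤ) (hS : IsProfile n p S) (hb : b.support.Finite) {k : ℤ}
    (hk : k % 2 = n % 2) :
    sigmaP a1 a2 (bump b S) k = sigmaP a1 a2 b k + S k + S (k + 1) := by
  unfold sigmaP
  rw [finsum_gt_bump hS hb (G := 2) (fun j hj => by simp [pairJK, hj, hk])]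
  unfold bump
  ring

theorem sigmaP_bump_other (a1 a2 : ℤ) (hS : IsProfile n p S) (hb : b.support.Finite) {k : ℤ}
    (hk : k % 2 ≠ n % 2) :
    sigmaP a1 a2 (bump b S) k = sigmaP a1 a2 b k - aIdx a1 a2 k * S (k + 1) := by
  unfold sigmaP
  rw [finsum_gt_bump hS hb (G := -aIdx a1 a2 k)
    (fun j hj => by unfold pairJK aIdx; split_ifs <;> first | rfl | omega)]
  unfold bump
  rw [hS.const k hk]
  ring

theorem sigmaM_bump_same (a1 a2 : ℤ) (hS : IsProfile n p S) (hb : b.support.Finite) {k : ℤ}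
    (hk : k % 2 = n % 2) :
    sigmaM a1 a2 (bump b S) k = sigmaM a1 a2 b k + S k + S (k + 1) - 2 * p := by
  unfold sigmaM
  rw [finsum_lt_bump hS hb (G := 2) (fun j hj => by simp [pairJK, hj, hk])]
  unfold bump
  ring

theorem wtOf_bump (a1 a2 : ℤ) (hS : IsProfile n p S) (hb : b.support.Finite) :
    wtOf a1 a2 (bump b S) = wtOf a1 a2 b - p • alphaOf a1 a2 n := by
  have key : ∀ g : ℤ → ℤ, (∀ j, j % 2 = n % 2 → g j = g n) →
      ∑ᶠ j, bump b S j * g j = ∑ᶠ j, b j * g j + p * g n := by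
    intro g hg
    rw [← hS.weighted_finsum hg, ← finsum_add_distrib (finite_support_mul hb _)
      (finite_support_mul hS.support_finite _)]
    exact finsum_congr fun j => by unfold bump; ring
  have hα : ∀ j, j % 2 = n % 2 → alphaOf a1 a2 j = alphaOf a1 a2 n := by
    intro j hj
    simp [alphaOf, hj]
  unfold wtOf
  rw [key (fun j => (alphaOf a1 a2 j).1) (fun j hj => by simp [hα j hj]),
    key (fun j => (alphaOf a1 a2 j).2) (fun j hj => by simp [hα j hj])]
  ext <;> simp <;> ring

theorem pairW_alphaOf_same (a1 a2 : ℤ) {k n : ℤ} (hk : k % 2 = n % 2) :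
    pairW (alphaOf a1 a2 n) (idx k) = 2 := by
  unfold pairW alphaOf idx
  rw [hk]
  split_ifs <;> simp_all

theorem pairW_alphaOf_other (a1 a2 : ℤ) {k n : ℤ} (hk : k % 2 ≠ n % 2) :
    pairW (alphaOf a1 a2 n) (idx k) = -aIdx a1 a2 k := by
  unfold pairW alphaOf idx aIdx
  split_ifs <;> first | rfl | omega

theorem pairW_sub_smul (v w : ℤ × ℤ) (p i : ℤ) :
    pairW (v - p • w) i = pairW v i - p * pairW w i := by
  unfold pairW
  split_ifs <;> simp

theorem wtZ_bump (a1 a2 : ℤ) (μ : ℤ × ℤ) (hS : IsProfile n p S) (hb : b.support.Finite) :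
    wtZ a1 a2 μ (bump b S) = wtZ a1 a2 μ b - p • alphaOf a1 a2 n := by
  unfold wtZ
  rw [wtOf_bump a1 a2 hS hb]
  abel

theorem sigmaZ_bump_same (a1 a2 : ℤ) (μ : ℤ × ℤ) (hS : IsProfile n p S) (hb : b.support.Finite)
    {k : ℤ} (hk : k % 2 = n % 2) :
    sigmaZ a1 a2 μ (bump b S) k = sigmaZ a1 a2 μ b k + S k + S (k + 1) := by
  unfold sigmaZ
  split_ifs with h
  · exact sigmaP_bump_same a1 a2 hS hb hk
  · rw [sigmaM_bump_same a1 a2 hS hb hk, wtZ_bump a1 a2 μ hS hb, pairW_sub_smul,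
      pairW_alphaOf_same a1 a2 hk]
    ring

end Bump

theorem IsProfile.exists_drop {n p : ℤ} {S : ℤ → ℤ} (hS : IsProfile n p S) {s : ℤ} (h0 : 0 ≤ s)
    (hs : s < p) : ∃ k₀, k₀ % 2 = n % 2 ∧ s < S k₀ ∧ S (k₀ + 1) ≤ s := by
  obtain ⟨K, hK⟩ := hS.low
  obtain ⟨L, hL⟩ := hS.high
  obtain ⟨k₀, h1, h2⟩ := Int.exists_greatest_of_bdd (P := fun k => s < S k)
    ⟨L, fun k hk => by
      by_contra hcon
      rw [hL k (by omega)] at hk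
      omega⟩ ⟨K, by rw [hK K le_rfl]; exact hs⟩
  have h3 : S (k₀ + 1) ≤ s := by
    by_contra hcon
    have := h2 (k₀ + 1) (not_le.mp hcon)
    omega
  refine ⟨k₀, ?_, h1, h3⟩
  by_contra hcon
  rw [hS.const k₀ hcon] at h3
  omega

theorem bump_min_succ {n p : ℤ} {S : ℤ → ℤ} (hS : IsProfile n p S) (b : ℤ → ℤ) {s k₀ : ℤ}
    (h1 : s < S k₀) (h2 : S (k₀ + 1) ≤ s) :
    bump b (fun k => min (s + 1) (S k)) =
      Function.update (bump b fun k => min s (S k)) k₀ (bump b (fun k => min s (S k)) k₀ + 1) := by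
  funext k
  rcases eq_or_ne k k₀ with rfl | hk
  · rw [Function.update_self]
    unfold bump
    beta_reduce
    omega
  · rw [Function.update_of_ne hk]
    unfold bump
    rcases lt_or_gt_of_ne hk with h | h
    · have := hS.antitone (show k ≤ k₀ by omega)
      have := hS.antitone (show k + 1 ≤ k₀ by omega)
      beta_reduce
      omega
    · have := hS.antitone (show k₀ + 1 ≤ k by omega)
      have := hS.antitone (show k₀ + 1 ≤ k + 1 by omega)
      beta_reduce
      omega

/-- The position at which a partially applied profile grows next is the lowest position where the
signature is maximal before the step, and the highest such position after it. -/
theorem signature_at_drop {n p : ℤ} {S σ : ℤ → ℤ} (hS : IsProfile n p S) {D : ℤ → Prop}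
    (hD : ∀ k, ¬ D k → S (k + 1) = S k)
    (hσ : ∀ k, D k → k % 2 = n % 2 → S (k + 1) = min (S k) (-σ k))
    {s k₀ : ℤ} (h1 : s < S k₀) (h2 : S (k₀ + 1) ≤ s) :
    D k₀ ∧
    (∀ k, D k → k % 2 = n % 2 → σ k + min s (S k) + min s (S (k + 1)) ≤ s) ∧
    σ k₀ + min s (S k₀) + min s (S (k₀ + 1)) = s ∧
    (∀ k, D k → k % 2 = n % 2 → σ k + min s (S k) + min s (S (k + 1)) = s → k₀ ≤ k) ∧
    (∀ k, D k → k % 2 = n % 2 →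
      σ k + min (s + 1) (S k) + min (s + 1) (S (k + 1)) ≤ s + 1) ∧
    σ k₀ + min (s + 1) (S k₀) + min (s + 1) (S (k₀ + 1)) = s + 1 ∧
    (∀ k, D k → k % 2 = n % 2 →
      σ k + min (s + 1) (S k) + min (s + 1) (S (k + 1)) = s + 1 → k ≤ k₀) := by
  have hD₀ : D k₀ := by
    by_contra h
    have := hD k₀ h
    omega
  have hp₀ : k₀ % 2 = n % 2 := by
    by_contra h
    have := hS.const k₀ h
    omega
  have h₀ := hσ k₀ hD₀ hp₀
  refine ⟨hD₀, ?_, by omega, ?_, ?_, by omega, ?_⟩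
  · intro k hk hp
    have := hσ k hk hp
    omega
  · intro k hk hp he
    have := hσ k hk hp
    by_contra hcon
    have := hS.antitone (show k + 1 ≤ k₀ by omega)
    omega
  · intro k hk hp
    have := hσ k hk hp
    omega
  · intro k hk hp he
    have := hσ k hk hp
    by_contra hcon
    have := hS.antitone (show k₀ + 1 ≤ k by omega)
    omega

theorem bump_zero_profile (b : ℤ → ℤ) {n p : ℤ} {S : ℤ → ℤ} (hS : IsProfile n p S) :
    bump b (fun k => min 0 (S k)) = b := by
  funext k
  simp [bump, hS.nonneg]

theorem bump_min_top (b : ℤ → ℤ) {n p : ℤ} {S : ℤ → ℤ} (hS : IsProfile n p S) :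
    bump b (fun k => min p (S k)) = bump b S := by
  funext k
  simp [bump, hS.le]

/-- `w'` is obtained from `w` by `f̃_{i_n}^s` on `ℤ^{+∞}`, where `ε_{i_n}(w) = 0`. -/
def StepP (a1 a2 n s : ℤ) (w w' : ℤ → ℤ) : Prop :=
  ∃ S, IsProfile n s S ∧ (∀ k ≤ 1, S k = s) ∧
    (∀ k, 1 ≤ k → k % 2 = n % 2 → S (k + 1) = min (S k) (-sigmaP a1 a2 w k)) ∧ w' = bump w S

/-- `b'` is obtained from `b` by `f̃_{i_n}^p` on `Z_ι(μ)`, where `ε_{i_n}(b) = 0` and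
`φ_{i_n}(b) = p`. -/
def StepZ (a1 a2 : ℤ) (μ : ℤ × ℤ) (n p : ℤ) (b b' : ℤ → ℤ) : Prop :=
  ∃ S, IsProfile n p S ∧
    (∀ k, k % 2 = n % 2 → S (k + 1) = min (S k) (-sigmaZ a1 a2 μ b k)) ∧ b' = bump b S

theorem StepP.fPiter_eq {a1 a2 n s : ℤ} {w w' : ℤ → ℤ} (h : StepP a1 a2 n s w w')
    (hw : w.support.Finite) : fPiter a1 a2 (idx n) s.toNat w = w' := by
  obtain ⟨S, hS, hlow, hσ, rfl⟩ := h
  have hs : 0 ≤ s := by rw [← hlow 1 le_rfl]; exact hS.nonneg 1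
  have main : ∀ m : ℕ, (m : ℤ) ≤ s →
      fPiter a1 a2 (idx n) m w = bump w fun k => min (m : ℤ) (S k) := by
    intro m
    induction m with
    | zero => intro _; simpa [fPiter] using (bump_zero_profile w hS).symm
    | succ m ih =>
      intro hm
      push_cast at hm ⊢
      obtain ⟨k₀, hp₀, h1, h2⟩ := hS.exists_drop (s := (m : ℤ)) (by omega) (by omega)
      obtain ⟨hD₀, hle, heq, hmin, -⟩ := signature_at_drop hS (D := fun k => 1 ≤ k)
        (fun k hk => by rw [hlow k (by omega), hlow (k + 1) (by omega)]) hσ h1 h2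
      have hst : fPiter a1 a2 (idx n) (m + 1) w =
          fP a1 a2 (idx n) (bump w fun k => min (m : ℤ) (S k)) := by
        rw [← ih (by omega)]
        exact Function.iterate_succ_apply' _ _ _
      have hsig : ∀ k, k % 2 = n % 2 → sigmaP a1 a2 (bump w fun k => min (m : ℤ) (S k)) k =
          sigmaP a1 a2 w k + min (m : ℤ) (S k) + min (m : ℤ) (S (k + 1)) := fun k hk =>
        sigmaP_bump_same a1 a2 (hS.inf (by omega) (by omega)) hw hk
      have heps : epsP a1 a2 (bump w fun k => min (m : ℤ) (S k)) (idx n) = m := by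
        apply IsGreatest.csSup_eq
        refine ⟨⟨k₀, hD₀, idx_eq_idx_iff.mpr hp₀, by rw [hsig k₀ hp₀, heq]⟩, ?_⟩
        rintro _ ⟨k, hk, hi, rfl⟩
        have hk2 := idx_eq_idx_iff.mp hi
        rw [hsig k hk2]
        exact hle k hk hk2
      have hkmin : kminP a1 a2 (bump w fun k => min (m : ℤ) (S k)) (idx n) = k₀ := by
        apply IsLeast.csInf_eq
        rw [heps]
        refine ⟨⟨hD₀, idx_eq_idx_iff.mpr hp₀, by rw [hsig k₀ hp₀, heq]⟩, ?_⟩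
        rintro k ⟨hk, hi, he⟩
        have hk2 := idx_eq_idx_iff.mp hi
        rw [hsig k hk2] at he
        exact hmin k hk hk2 he
      rw [hst, fP, hkmin, bump_min_succ hS w h1 h2]
  have := main s.toNat (by omega)
  rw [this, Int.toNat_of_nonneg hs, bump_min_top w hS]

section StepZ

variable {a1 a2 n p : ℤ} {μ : ℤ × ℤ} {b b' : ℤ → ℤ}

theorem sigmaP_eq_zero_of_large (a1 a2 : ℤ) {b : ℤ → ℤ} (hb : b.support.Finite) :
    ∃ L, ∀ k, L ≤ k → sigmaP a1 a2 b k = 0 := by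
  obtain ⟨L, hL⟩ := hb.bddAbove
  have h0 : ∀ k, L < k → b k = 0 := by
    intro k hk
    by_contra h
    have := hL (Function.mem_support.mpr h)
    omega
  refine ⟨L + 1, fun k hk => ?_⟩
  unfold sigmaP
  rw [h0 k (by omega), finsum_eq_zero_of_forall_eq_zero, add_zero]
  intro j
  split_ifs with h
  · rw [h0 j (by omega), mul_zero]
  · rfl

theorem sigmaM_eq_zero_of_small (a1 a2 : ℤ) {b : ℤ → ℤ} (hb : b.support.Finite) :
    ∃ K, ∀ k ≤ K, sigmaM a1 a2 b k = 0 := by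
  obtain ⟨K, hK⟩ := hb.bddBelow
  have h0 : ∀ k, k < K → b k = 0 := by
    intro k hk
    by_contra h
    have := hK (Function.mem_support.mpr h)
    omega
  refine ⟨K - 1, fun k hk => ?_⟩
  unfold sigmaM
  rw [h0 k (by omega), finsum_eq_zero_of_forall_eq_zero, neg_zero, sub_zero]
  intro j
  split_ifs with h
  · rw [h0 j (by omega), mul_zero]
  · rfl

theorem exists_large_same_parity (L n : ℤ) : ∃ k, L ≤ k ∧ k % 2 = n % 2 := by
  by_cases h : L % 2 = n % 2
  · exact ⟨L, le_rfl, h⟩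
  · exact ⟨L + 1, by omega, by omega⟩

theorem exists_small_same_parity (K n : ℤ) : ∃ k, k ≤ K ∧ k % 2 = n % 2 := by
  by_cases h : K % 2 = n % 2
  · exact ⟨K, le_rfl, h⟩
  · exact ⟨K - 1, by omega, by omega⟩

theorem StepZ.epsZ_source (h : StepZ a1 a2 μ n p b b') (hb : b.support.Finite) :
    epsZ a1 a2 μ b (idx n) = 0 := by
  obtain ⟨S, hS, hσ, -⟩ := h
  apply IsGreatest.csSup_eq
  constructor
  · obtain ⟨L, hL⟩ := sigmaP_eq_zero_of_large a1 a2 hb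
    obtain ⟨k, hk, hk2⟩ := exists_large_same_parity (max 1 L) n
    refine ⟨k, idx_eq_idx_iff.mpr hk2, ?_⟩
    rw [sigmaZ, if_pos (by omega), hL k (by omega)]
  · rintro _ ⟨k, hi, rfl⟩
    have := hσ k (idx_eq_idx_iff.mp hi)
    have := hS.nonneg (k + 1)
    omega

theorem StepZ.epsZ_target (h : StepZ a1 a2 μ n p b b') (hb : b.support.Finite)
    (hwt : pairW (wtZ a1 a2 μ b) (idx n) = p) : epsZ a1 a2 μ b' (idx n) = p := by
  obtain ⟨S, hS, hσ, rfl⟩ := h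
  apply IsGreatest.csSup_eq
  constructor
  · obtain ⟨K, hK⟩ := sigmaM_eq_zero_of_small a1 a2 hb
    obtain ⟨K', hK'⟩ := hS.low
    obtain ⟨k, hk, hk2⟩ := exists_small_same_parity (min (min 0 K) (K' - 1)) n
    refine ⟨k, idx_eq_idx_iff.mpr hk2, ?_⟩
    rw [sigmaZ_bump_same a1 a2 μ hS hb hk2, sigmaZ, if_neg (by omega), hK k (by omega),
      hK' k (by omega), hK' (k + 1) (by omega), idx_eq_idx_iff.mpr hk2, hwt]
    ring
  · rintro _ ⟨k, hi, rfl⟩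
    have hk2 := idx_eq_idx_iff.mp hi
    have := hσ k hk2
    have := hS.le k
    rw [sigmaZ_bump_same a1 a2 μ hS hb hk2]
    omega

/-- The intermediate elements of a step, together with both crystal operators between them. -/
theorem StepZ.exists_string (h : StepZ a1 a2 μ n p b b') (hb : b.support.Finite)
    (hwt : pairW (wtZ a1 a2 μ b) (idx n) = p) :
    0 ≤ p ∧ ∃ c : ℕ → ℤ → ℤ, c 0 = b ∧ c p.toNat = b' ∧ ∀ m : ℕ, (m : ℤ) < p →
      fZ a1 a2 μ (idx n) (c m) = some (c (m + 1)) ∧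
      eZ a1 a2 μ (idx n) (c (m + 1)) = some (c m) := by
  obtain ⟨S, hS, hσ, rfl⟩ := h
  have hp : 0 ≤ p := le_trans (hS.nonneg 0) (hS.le 0)
  refine ⟨hp, fun m => bump b fun k => min (m : ℤ) (S k), by simpa using bump_zero_profile b hS,
    by simp only [Int.toNat_of_nonneg hp]; exact bump_min_top b hS, fun m hm => ?_⟩
  obtain ⟨k₀, hp₀, h1, h2⟩ := hS.exists_drop (s := (m : ℤ)) (by omega) hm
  obtain ⟨-, hle, heq, hmin, hle', heq', hmax⟩ := signature_at_drop hS (D := fun _ => True)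
    (fun k hk => absurd trivial hk) (fun k _ => hσ k) h1 h2
  have hsig : ∀ s : ℤ, 0 ≤ s → s ≤ p → ∀ k, k % 2 = n % 2 →
      sigmaZ a1 a2 μ (bump b fun k => min s (S k)) k =
      sigmaZ a1 a2 μ b k + min s (S k) + min s (S (k + 1)) := fun s hs0 hs k hk =>
    sigmaZ_bump_same a1 a2 μ (hS.inf hs0 hs) hb hk
  have hsig0 := hsig m (by omega) (by omega)
  have hsig1 := hsig (m + 1) (by omega) (by omega)
  have heps : epsZ a1 a2 μ (bump b fun k => min (m : ℤ) (S k)) (idx n) = m := by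
    apply IsGreatest.csSup_eq
    refine ⟨⟨k₀, idx_eq_idx_iff.mpr hp₀, by rw [hsig0 k₀ hp₀, heq]⟩, ?_⟩
    rintro _ ⟨k, hi, rfl⟩
    have hk2 := idx_eq_idx_iff.mp hi
    rw [hsig0 k hk2]
    exact hle k trivial hk2
  have heps' : epsZ a1 a2 μ (bump b fun k => min ((m : ℤ) + 1) (S k)) (idx n) = m + 1 := by
    apply IsGreatest.csSup_eq
    refine ⟨⟨k₀, idx_eq_idx_iff.mpr hp₀, by rw [hsig1 k₀ hp₀, heq']⟩, ?_⟩
    rintro _ ⟨k, hi, rfl⟩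
    have hk2 := idx_eq_idx_iff.mp hi
    rw [hsig1 k hk2]
    exact hle' k trivial hk2
  have hkmin : kminZ a1 a2 μ (bump b fun k => min (m : ℤ) (S k)) (idx n) = k₀ := by
    apply IsLeast.csInf_eq
    rw [heps]
    refine ⟨⟨idx_eq_idx_iff.mpr hp₀, by rw [hsig0 k₀ hp₀, heq]⟩, ?_⟩
    rintro k ⟨hi, he⟩
    have hk2 := idx_eq_idx_iff.mp hi
    rw [hsig0 k hk2] at he
    exact hmin k trivial hk2 he
  have hkmax : kmaxZ a1 a2 μ (bump b fun k => min ((m : ℤ) + 1) (S k)) (idx n) = k₀ := by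
    apply IsGreatest.csSup_eq
    rw [heps']
    refine ⟨⟨idx_eq_idx_iff.mpr hp₀, by rw [hsig1 k₀ hp₀, heq']⟩, ?_⟩
    rintro k ⟨hi, he⟩
    have hk2 := idx_eq_idx_iff.mp hi
    rw [hsig1 k hk2] at he
    exact hmax k trivial hk2 he
  have hphi : phiZ a1 a2 μ (bump b fun k => min (m : ℤ) (S k)) (idx n) = p - m := by
    rw [phiZ, heps, wtZ_bump a1 a2 μ (hS.inf (by omega) (by omega)) hb, pairW_sub_smul,
      pairW_alphaOf_same a1 a2 rfl, hwt]
    ring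
  push_cast
  constructor
  · rw [fZ, if_pos (by omega), hkmin, bump_min_succ hS b h1 h2]
  · rw [eZ, if_pos (by omega), hkmax, bump_min_succ hS b h1 h2]
    simp

theorem StepZ.fZiterO_eq (h : StepZ a1 a2 μ n p b b') (hb : b.support.Finite)
    (hwt : pairW (wtZ a1 a2 μ b) (idx n) = p) :
    fZiterO a1 a2 μ (idx n) p.toNat (some b) = some b' := by
  obtain ⟨hp, c, rfl, rfl, hc⟩ := h.exists_string hb hwt
  have main : ∀ m : ℕ, (m : ℤ) ≤ p → fZiterO a1 a2 μ (idx n) m (some (c 0)) = some (c m) := by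
    intro m
    induction m with
    | zero => intro _; rfl
    | succ m ih =>
      intro hm
      push_cast at hm
      have := ih (by omega)
      unfold fZiterO at this ⊢
      rw [Function.iterate_succ_apply', this]
      exact (hc m (by omega)).1
  exact main _ (by omega)

theorem StepZ.eZiterO_eq (h : StepZ a1 a2 μ n p b b') (hb : b.support.Finite)
    (hwt : pairW (wtZ a1 a2 μ b) (idx n) = p) :
    eZiterO a1 a2 μ (idx n) p.toNat (some b') = some b := by
  obtain ⟨hp, c, rfl, rfl, hc⟩ := h.exists_string hb hwt
  have main : ∀ m : ℕ, (m : ℤ) ≤ p → eZiterO a1 a2 μ (idx n) m (some (c m)) = some (c 0) := by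
    intro m
    induction m with
    | zero => intro _; rfl
    | succ m ih =>
      intro hm
      push_cast at hm
      have := ih (by omega)
      unfold eZiterO at this ⊢
      rw [Function.iterate_succ_apply, Option.bind_some, (hc m (by omega)).2, this]
  exact main _ (by omega)

end StepZ

/-- An orbit indexed by `ℤ` whose consecutive elements are related by full strings consists of
extremal elements. -/
theorem extremal_of_stepZ {a1 a2 : ℤ} {μ : ℤ × ℤ} {p : ℤ → ℤ} {b : ℤ → ℤ → ℤ}
    (hp : ∀ n, 0 ≤ p n) (hb : ∀ n, (b n).support.Finite)
    (hstep : ∀ n, StepZ a1 a2 μ n (p n) (b n) (b (n - 1)))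
    (hwt : ∀ n, pairW (wtZ a1 a2 μ (b n)) (idx n) = p n)
    (hwt' : ∀ n, pairW (wtZ a1 a2 μ (b n)) (idx (n + 1)) = -p (n + 1)) (n₀ : ℤ) :
    Extremal a1 a2 μ (b n₀) := by
  have hidx : ∀ i, IsI i → ∀ n, i = idx n ∨ i = idx (n + 1) := by
    rintro i (rfl | rfl) n <;> unfold idx <;> split_ifs <;> simp <;> omega
  have hstep' : ∀ n, StepZ a1 a2 μ (n + 1) (p (n + 1)) (b (n + 1)) (b n) := by
    intro n
    simpa using hstep (n + 1)
  intro js hjs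
  have horbit : ∃ n, js.foldr (SiO a1 a2 μ) (some (b n₀)) = some (b n) := by
    induction js with
    | nil => exact ⟨n₀, rfl⟩
    | cons j js ih =>
      obtain ⟨n, hn⟩ := ih fun j hj => hjs j (List.mem_cons_of_mem _ hj)
      rw [List.foldr_cons, hn]
      rcases hidx j (hjs j List.mem_cons_self) n with rfl | rfl
      · refine ⟨n - 1, ?_⟩
        rw [SiO, Option.bind_some, hwt, if_pos (hp n)]
        exact (hstep n).fZiterO_eq (hb n) (hwt n)
      · rw [SiO, Option.bind_some, hwt']
        by_cases h0 : p (n + 1) = 0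
        · exact ⟨n, by simp [h0, fZiterO]⟩
        · refine ⟨n + 1, ?_⟩
          have := hp (n + 1)
          rw [if_neg (by omega), neg_neg]
          exact (hstep' n).eZiterO_eq (hb _) (hwt _)
  obtain ⟨n, hn⟩ := horbit
  refine ⟨b n, hn, fun i hi => ?_⟩
  have h1 := (hstep n).epsZ_source (hb n)
  have h2 := (hstep' n).epsZ_target (hb _) (hwt _)
  rcases hidx i hi n with rfl | rfl
  · rw [eZ, fZ, phiZ, hwt, h1]
    exact ⟨fun _ => if_neg (by omega), fun h => if_neg (by omega)⟩
  · rw [eZ, fZ, phiZ, hwt', h2]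
    exact ⟨fun h => if_neg (by omega), fun _ => if_neg (by omega)⟩

theorem gammaR_congr (a1 a2 : ℤ) {k l : ℤ} (h : k % 2 = l % 2) :
    gammaR a1 a2 k = gammaR a1 a2 l := by
  unfold gammaR
  rw [h]

theorem gammaR_swap (a1 a2 : ℤ) {k l : ℤ} (h : k % 2 ≠ l % 2) :
    gammaR a2 a1 k = gammaR a1 a2 l := by
  have hα : alphaR a2 a1 = betaR a1 a2 := by unfold alphaR betaR; ring_nf
  have hβ : betaR a2 a1 = alphaR a1 a2 := by unfold alphaR betaR; ring_nf
  unfold gammaR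
  split_ifs <;> first | assumption | omega

theorem gammaR_pos {a1 a2 : ℤ} (ha1 : 1 ≤ a1) (ha2 : 1 ≤ a2) (k : ℤ) : 0 < gammaR a1 a2 k := by
  have h1 : (0 : ℝ) < a1 := by exact_mod_cast ha1
  have h2 : (0 : ℝ) < a2 := by exact_mod_cast ha2
  unfold gammaR alphaR betaR
  split_ifs <;> positivity

theorem gammaR_mul {a1 a2 : ℤ} (ha1 : 1 ≤ a1) (ha2 : 1 ≤ a2) (ha : 4 < a1 * a2) {k l : ℤ}
    (h : k % 2 ≠ l % 2) :
    gammaR a1 a2 k * (aIdx a1 a2 k - gammaR a1 a2 l) = 1 := by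
  have h1 : (0 : ℝ) < a1 := by exact_mod_cast ha1
  have h2 : (0 : ℝ) < a2 := by exact_mod_cast ha2
  have h4 : (4 : ℝ) < a1 * a2 := by exact_mod_cast ha
  have hsq : Real.sqrt ((a1 : ℝ) ^ 2 * (a2 : ℝ) ^ 2 - 4 * a1 * a2) ^ 2 =
      (a1 : ℝ) ^ 2 * (a2 : ℝ) ^ 2 - 4 * a1 * a2 := by
    apply Real.sq_sqrt
    nlinarith
  have hαβ : betaR a1 a2 * (a1 - alphaR a1 a2) = 1 := by
    unfold alphaR betaR
    generalize Real.sqrt _ = r at hsq ⊢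
    field_simp
    linear_combination -hsq
  have hβα : alphaR a1 a2 * (a2 - betaR a1 a2) = 1 := by
    unfold alphaR betaR
    generalize Real.sqrt _ = r at hsq ⊢
    field_simp
    linear_combination -hsq
  unfold gammaR aIdx
  split_ifs <;> first | assumption | omega

/-- The profile of `f̃_{i_n}^s` on `w`, at position `m + 1`. -/
noncomputable def profileNat (a1 a2 n s : ℤ) (w : ℤ → ℤ) : ℕ → ℤ
  | 0 => s
  | m + 1 => if ((m : ℤ) + 1) % 2 = n % 2 then
      min (profileNat a1 a2 n s w m) (-sigmaP a1 a2 w ((m : ℤ) + 1))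
    else profileNat a1 a2 n s w m

/-- The profile of `f̃_{i_n}^s` on `w`. -/
noncomputable def profile (a1 a2 n s : ℤ) (w : ℤ → ℤ) (k : ℤ) : ℤ :=
  profileNat a1 a2 n s w (k - 1).toNat

section Profile

variable (a1 a2 n s : ℤ) (w : ℤ → ℤ)

theorem profile_of_le_one {k : ℤ} (hk : k ≤ 1) : profile a1 a2 n s w k = s := by
  rw [profile, Int.toNat_of_nonpos (by omega), profileNat]

theorem profile_succ_same {k : ℤ} (hk : 1 ≤ k) (hp : k % 2 = n % 2) :
    profile a1 a2 n s w (k + 1) = min (profile a1 a2 n s w k) (-sigmaP a1 a2 w k) := by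
  obtain ⟨m, rfl⟩ : ∃ m : ℕ, k = m + 1 := ⟨(k - 1).toNat, by omega⟩
  have h1 : ((m : ℤ) + 1 + 1 - 1).toNat = m + 1 := by omega
  have h2 : ((m : ℤ) + 1 - 1).toNat = m := by omega
  rw [profile, profile, h1, h2, profileNat, if_pos hp]

theorem profile_succ_other {k : ℤ} (hp : k % 2 ≠ n % 2) :
    profile a1 a2 n s w (k + 1) = profile a1 a2 n s w k := by
  rcases lt_or_ge k 1 with hk | hk
  · rw [profile_of_le_one _ _ _ _ _ (by omega), profile_of_le_one _ _ _ _ _ (by omega)]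
  obtain ⟨m, rfl⟩ : ∃ m : ℕ, k = m + 1 := ⟨(k - 1).toNat, by omega⟩
  have h1 : ((m : ℤ) + 1 + 1 - 1).toNat = m + 1 := by omega
  have h2 : ((m : ℤ) + 1 - 1).toNat = m := by omega
  rw [profile, profile, h1, h2, profileNat, if_neg hp]

variable {a1 a2 n s w}

theorem isProfile_profile (hs : 0 ≤ s) (hw : w.support.Finite)
    (hσ : ∀ k, 1 ≤ k → k % 2 = n % 2 → sigmaP a1 a2 w k ≤ 0) :
    IsProfile n s (profile a1 a2 n s w) := by
  have hanti : ∀ k, profile a1 a2 n s w (k + 1) ≤ profile a1 a2 n s w k := by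
    intro k
    by_cases hp : k % 2 = n % 2
    · rcases lt_or_ge k 1 with hk | hk
      · rw [profile_of_le_one _ _ _ _ _ (by omega), profile_of_le_one _ _ _ _ _ (by omega)]
      · rw [profile_succ_same _ _ _ _ _ hk hp]
        exact min_le_left _ _
    · rw [profile_succ_other _ _ _ _ _ hp]
  have hnonneg : ∀ m, 0 ≤ profileNat a1 a2 n s w m := by
    intro m
    induction m with
    | zero => exact hs
    | succ m ih =>
      rw [profileNat]
      split_ifs with hp
      · exact le_min ih (neg_nonneg.mpr (hσ _ (by omega) hp))
      · exact ih
  refine ⟨⟨1, fun k hk => profile_of_le_one _ _ _ _ _ hk⟩, ?_, hanti,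
    fun k hk => profile_succ_other _ _ _ _ _ hk⟩
  obtain ⟨L, hL⟩ := sigmaP_eq_zero_of_large a1 a2 hw
  obtain ⟨k, hk, hk2⟩ := exists_large_same_parity (max 1 L) n
  refine ⟨k + 1, fun l hl => le_antisymm ?_ (hnonneg _)⟩
  calc profile a1 a2 n s w l ≤ profile a1 a2 n s w (k + 1) := antitone_int_of_succ_le hanti hl
    _ ≤ -sigmaP a1 a2 w k := by
        rw [profile_succ_same _ _ _ _ _ (by omega) hk2]
        exact min_le_right _ _
    _ = 0 := by rw [hL k (by omega), neg_zero]

theorem stepP_profile (hs : 0 ≤ s) (hw : w.support.Finite)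
    (hσ : ∀ k, 1 ≤ k → k % 2 = n % 2 → sigmaP a1 a2 w k ≤ 0) :
    StepP a1 a2 n s w (bump w (profile a1 a2 n s w)) :=
  ⟨_, isProfile_profile hs hw hσ, fun _ hk => profile_of_le_one _ _ _ _ _ hk,
    fun _ hk hp => profile_succ_same _ _ _ _ _ hk hp, rfl⟩

end Profile

/-- The sequence `f̃_{i_{c-m+1}}^{t_{m-1}} ⋯ f̃_{i_{c-1}}^{t_1} f̃_{i_c}^{t_0} (z_∞)`. -/
noncomputable def chain (a1 a2 c : ℤ) (t : ℕ → ℤ) : ℕ → ℤ → ℤ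
  | 0 => 0
  | m + 1 => bump (chain a1 a2 c t m) (profile a1 a2 (c - m) (t m) (chain a1 a2 c t m))

theorem sigmaP_zero (a1 a2 k : ℤ) : sigmaP a1 a2 0 k = 0 := by
  simp [sigmaP]

section Chain

variable {a1 a2 : ℤ} {c : ℤ} {t : ℕ → ℤ}

theorem chain_invariant (ha1 : 1 ≤ a1) (ha2 : 1 ≤ a2) (ha : 4 < a1 * a2) (ht0 : ∀ m, 0 ≤ t m)
    (ht : ∀ m : ℕ, (t m : ℝ) ≤ gammaR a1 a2 (c - m - 1) * t (m + 1)) (m : ℕ) :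
    (chain a1 a2 c t m).support.Finite ∧ ∃ T : ℤ → ℝ, Antitone T ∧ (∀ k, 0 ≤ T k) ∧
      T 1 ≤ gammaR a1 a2 (c - m) * t m ∧
      (∀ k, 1 ≤ k → k % 2 ≠ (c - m) % 2 → (sigmaP a1 a2 (chain a1 a2 c t m) k : ℝ) ≤ T k) ∧
      (∀ k, 1 ≤ k → k % 2 = (c - m) % 2 →
        T (k + 1) ≤ -(gammaR a1 a2 (c - m) * sigmaP a1 a2 (chain a1 a2 c t m) k)) := by
  induction m with
  | zero =>
    refine ⟨by simp [chain], fun _ => 0, antitone_const, fun _ => le_rfl, ?_, ?_, ?_⟩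
    · exact mul_nonneg (gammaR_pos ha1 ha2 _).le (by exact_mod_cast ht0 0)
    · intro k _ _
      simp [chain, sigmaP_zero]
    · intro k _ _
      simp [chain, sigmaP_zero]
  | succ m ih =>
    obtain ⟨hfin, T, hTanti, hT0, hT1, hTo, hTs⟩ := ih
    set w := chain a1 a2 c t m with hw
    set γ := gammaR a1 a2 (c - m) with hγ
    have hγpos : 0 < γ := gammaR_pos ha1 ha2 _
    have hσ : ∀ k, 1 ≤ k → k % 2 = (c - m) % 2 → sigmaP a1 a2 w k ≤ 0 := by
      intro k hk hp
      have h1 : 0 ≤ γ * -(sigmaP a1 a2 w k : ℝ) := by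
        have := le_trans (hT0 (k + 1)) (hTs k hk hp)
        linarith
      have h2 : (0 : ℝ) ≤ -(sigmaP a1 a2 w k : ℝ) := nonneg_of_mul_nonneg_right h1 hγpos
      have h3 : (sigmaP a1 a2 w k : ℝ) ≤ 0 := by linarith
      exact_mod_cast h3
    set S := profile a1 a2 (c - m) (t m) w with hSdef
    have hS : IsProfile (c - m) (t m) S := isProfile_profile (ht0 m) hfin hσ
    have hchain : chain a1 a2 c t (m + 1) = bump w S := rfl
    have hTS : ∀ k, 1 ≤ k → T k ≤ γ * S k := by
      intro k hk
      induction k, hk using Int.leInduction with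
      | base => rwa [hSdef, profile_of_le_one _ _ _ _ _ le_rfl]
      | succ k hk ih =>
        have hTk : T (k + 1) ≤ T k := hTanti (by omega)
        by_cases hp : k % 2 = (c - m) % 2
        · rw [hSdef, profile_succ_same _ _ _ _ _ hk hp]
          rcases min_choice (profile a1 a2 (c - m) (t m) w k) (-sigmaP a1 a2 w k) with h | h
          · rw [h]
            exact hTk.trans ih
          · rw [h]
            push_cast
            have := hTs k hk hp
            linarith
        · rw [hS.const k hp]
          exact hTk.trans ih
    rw [hchain]
    refine ⟨finite_support_bump hS hfin, fun k => (S k : ℝ), fun k l hkl => ?_, fun k => ?_, ?_,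
      ?_, ?_⟩
    · beta_reduce
      exact_mod_cast hS.antitone hkl
    · beta_reduce
      exact_mod_cast hS.nonneg k
    · beta_reduce
      rw [hSdef, profile_of_le_one _ _ _ _ _ le_rfl]
      convert ht m using 2
      push_cast
      ring_nf
    · intro k hk hp
      push_cast at hp
      have hp' : k % 2 = (c - m) % 2 := by omega
      rw [sigmaP_bump_same a1 a2 hS hfin hp']
      have hmin : S (k + 1) = min (S k) (-sigmaP a1 a2 w k) :=
        profile_succ_same _ _ _ _ _ hk hp'
      have : sigmaP a1 a2 w k + S k + S (k + 1) ≤ S k := by omega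
      beta_reduce
      exact_mod_cast this
    · intro k hk hp
      push_cast at hp ⊢
      have hp' : k % 2 ≠ (c - m) % 2 := by omega
      rw [sigmaP_bump_other a1 a2 hS hfin hp',
        gammaR_congr a1 a2 (k := c - (m + 1)) (l := k) hp.symm]
      have hδ := gammaR_pos ha1 ha2 k
      have hrel := gammaR_mul ha1 ha2 ha hp'
      have h1 := (hTo k hk hp').trans (hTS k hk)
      have h2 : (sigmaP a1 a2 w k : ℝ) ≤ γ * S (k + 1) := by rwa [hS.const k hp']
      have h3 := mul_le_mul_of_nonneg_left h2 hδ.le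
      have h4 : (S (k + 1) : ℝ) =
          gammaR a1 a2 k * aIdx a1 a2 k * S (k + 1) - gammaR a1 a2 k * (γ * S (k + 1)) := by
        linear_combination (-(S (k + 1) : ℝ)) * hrel
      push_cast
      linarith

theorem stepP_chain (ha1 : 1 ≤ a1) (ha2 : 1 ≤ a2) (ha : 4 < a1 * a2) (ht0 : ∀ m, 0 ≤ t m)
    (ht : ∀ m : ℕ, (t m : ℝ) ≤ gammaR a1 a2 (c - m - 1) * t (m + 1)) (m : ℕ) :
    StepP a1 a2 (c - m) (t m) (chain a1 a2 c t m) (chain a1 a2 c t (m + 1)) := by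
  obtain ⟨hfin, T, -, hT0, -, -, hTs⟩ := chain_invariant ha1 ha2 ha ht0 ht m
  refine stepP_profile (ht0 m) hfin fun k hk hp => ?_
  have h1 : 0 ≤ gammaR a1 a2 (c - m) * -(sigmaP a1 a2 (chain a1 a2 c t m) k : ℝ) := by
    have := le_trans (hT0 (k + 1)) (hTs k hk hp)
    linarith
  have h2 := nonneg_of_mul_nonneg_right h1 (gammaR_pos ha1 ha2 _)
  have h3 : (sigmaP a1 a2 (chain a1 a2 c t m) k : ℝ) ≤ 0 := by linarith
  exact_mod_cast h3

end Chain

/-- The reflection exchanging `ℤ^{+∞}` and `ℤ^{−∞}`. -/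
def mirror (v : ℤ → ℤ) : ℤ → ℤ := fun k => -v (1 - k)

theorem sigmaM_mirror (a1 a2 : ℤ) (v : ℤ → ℤ) (k : ℤ) :
    sigmaM a1 a2 (mirror v) k = sigmaP a2 a1 v (1 - k) := by
  unfold sigmaM sigmaP
  rw [← finsum_comp_equiv (Equiv.subLeft (1 : ℤ)), sub_eq_add_neg, ← finsum_neg_distrib]
  simp only [mirror, neg_neg]
  congr 1
  refine finsum_congr fun j => ?_
  simp only [Equiv.subLeft_apply, sub_sub_cancel]
  by_cases h : j < 1 - k
  · rw [if_neg (by omega), if_neg (by omega), neg_zero]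
  · by_cases h' : 1 - k < j
    · rw [if_pos (by omega), if_pos h', mul_neg, neg_neg]
      congr 1
      unfold pairJK
      split_ifs <;> first | rfl | omega
    · rw [if_neg (by omega), if_neg (by omega), neg_zero]

theorem finite_support_mirror {v : ℤ → ℤ} (hv : v.support.Finite) : (mirror v).support.Finite := by
  refine (hv.image fun k => 1 - k).subset fun k hk => ?_
  refine ⟨1 - k, ?_, by simp⟩
  simpa [mirror] using hk

theorem finite_support_combine {y z : ℤ → ℤ} (hy : y.support.Finite) (hz : z.support.Finite) :
    (combine y z).support.Finite := by
  refine (hy.union hz).subset fun k hk => ?_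
  simp only [Function.mem_support, combine, Set.mem_union] at hk ⊢
  split_ifs at hk
  · exact Or.inl hk
  · exact Or.inr hk

theorem sigmaP_combine (a1 a2 : ℤ) (y z : ℤ → ℤ) {k : ℤ} (hk : 1 ≤ k) :
    sigmaP a1 a2 (combine y z) k = sigmaP a1 a2 y k := by
  unfold sigmaP combine
  rw [if_pos hk]
  congr 1
  refine finsum_congr fun j => ?_
  split_ifs <;> first | rfl | omega

theorem sigmaM_combine (a1 a2 : ℤ) (y z : ℤ → ℤ) {k : ℤ} (hk : k ≤ 0) :
    sigmaM a1 a2 (combine y z) k = sigmaM a1 a2 z k := by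
  unfold sigmaM combine
  rw [if_neg (by omega)]
  congr 1
  refine finsum_congr fun j => ?_
  split_ifs <;> first | rfl | omega

/-- A step on `ℤ^{+∞}` and a mirrored reverse step on `ℤ^{−∞}` combine to a step on `Z_ι(μ)`. -/
theorem exists_profile_combine {a1 a2 n s r : ℤ} {y y' v v' : ℤ → ℤ} (μ : ℤ × ℤ)
    (hy : StepP a1 a2 n s y y') (hv : StepP a2 a1 (1 - n) r v v') (hfin : v.support.Finite) :
    ∃ S, IsProfile n (s + r) S ∧
      combine y' (mirror v) = bump (combine y (mirror v')) S ∧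
      (pairW (wtZ a1 a2 μ (combine y (mirror v'))) (idx n) = s + r → ∀ k, k % 2 = n % 2 →
        S (k + 1) = min (S k) (-sigmaZ a1 a2 μ (combine y (mirror v')) k)) := by
  obtain ⟨S, hS, hSlow, hSσ, rfl⟩ := hy
  obtain ⟨R, hR, hRlow, hRσ, rfl⟩ := hv
  have hS1 : S 1 = s := hSlow 1 le_rfl
  have hR1 : R 1 = r := hRlow 1 le_rfl
  have hneg : ∀ k ≤ 1, (if 1 ≤ k then S k else s + r - R (2 - k)) = s + r - R (2 - k) := by
    intro k hk
    split_ifs with h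
    · obtain rfl : k = 1 := by omega
      rw [hS1, show (2 : ℤ) - 1 = 1 by norm_num, hR1]
      ring
    · rfl
  refine ⟨fun k => if 1 ≤ k then S k else s + r - R (2 - k), ⟨?_, ?_, ?_, ?_⟩, ?_, ?_⟩
  · obtain ⟨L, hL⟩ := hR.high
    refine ⟨min 0 (2 - L), fun k hk => ?_⟩
    rw [if_neg (by omega), hL _ (by omega), sub_zero]
  · obtain ⟨L, hL⟩ := hS.high
    refine ⟨max 1 L, fun k hk => ?_⟩
    rw [if_pos (by omega), hL _ (by omega)]
  · intro k
    rcases lt_or_ge k 1 with hk | hk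
    · rw [hneg k hk.le, hneg (k + 1) (by omega)]
      have := hR.antitone (show 2 - (k + 1) ≤ 2 - k by omega)
      omega
    · rw [if_pos hk, if_pos (by omega)]
      exact hS.anti k
  · intro k hp
    rcases lt_or_ge k 1 with hk | hk
    · rw [hneg k hk.le, hneg (k + 1) (by omega), show 2 - (k + 1) = 1 - k by ring,
        show 2 - k = (1 - k) + 1 by ring, hR.const (1 - k) (by omega)]
    · rw [if_pos hk, if_pos (by omega)]
      exact hS.const k hp
  · funext k
    rcases lt_or_ge k 1 with hk | hk
    · unfold bump
      beta_reduce
      rw [hneg k hk.le, hneg (k + 1) (by omega)]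
      simp only [combine, mirror, if_neg (not_le.mpr hk)]
      rw [show 2 - (k + 1) = 1 - k by ring, show 1 - k + 1 = 2 - k by ring]
      ring
    · simp only [bump, combine, if_pos hk, if_pos (show 1 ≤ k + 1 by omega)]
  · intro hwt k hp
    beta_reduce
    rcases lt_or_ge k 1 with hk | hk
    · have hσ := hRσ (1 - k) (by omega) (by omega)
      rw [hneg k hk.le, hneg (k + 1) (by omega), sigmaZ, if_neg (by omega),
        sigmaM_combine _ _ _ _ (by omega), sigmaM_mirror, idx_eq_idx_iff.mpr hp, hwt,
        sigmaP_bump_same a2 a1 hR hfin (by omega)]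
      rw [show 1 - k + 1 = 2 - k by ring] at hσ ⊢
      rw [show 2 - (k + 1) = 1 - k by ring]
      omega
    · rw [if_pos hk, if_pos (by omega), sigmaZ, if_pos hk, sigmaP_combine _ _ _ _ hk]
      exact hSσ k hk hp

theorem stepP_zero (a1 a2 n : ℤ) : StepP a1 a2 n 0 0 0 := by
  refine ⟨0, ⟨⟨0, fun _ _ => rfl⟩, ⟨0, fun _ _ => rfl⟩, fun _ => le_rfl, fun _ _ => rfl⟩,
    fun _ _ => rfl, fun k _ _ => by simp [sigmaP_zero], ?_⟩
  funext k
  simp [bump]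

theorem pseq_recurrence (a1 a2 k1 k2 n : ℤ) :
    pseq a1 a2 k1 k2 n + pseq a1 a2 k1 k2 (n + 2) =
      aIdx a1 a2 n * pseq a1 a2 k1 k2 (n + 1) := by
  rcases lt_trichotomy n (-1) with h | rfl | h
  · obtain ⟨m, rfl⟩ : ∃ m : ℕ, n = -((m : ℤ) + 2) := ⟨(-n - 2).toNat, by omega⟩
    have hneg : ∀ l : ℕ, pseq a1 a2 k1 k2 (-(l : ℤ)) = pneg a1 a2 k1 k2 l := by
      intro l
      unfold pseq
      split_ifs with hl
      · obtain rfl : l = 0 := by omega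
        simp [ppos, pneg]
      · simp
    have h2 := hneg (m + 2)
    have h1 := hneg (m + 1)
    push_cast at h1 h2
    rw [show -((m : ℤ) + 2) + 2 = -(m : ℤ) by ring, show -((m : ℤ) + 2) + 1 = -((m : ℤ) + 1) by ring,
      h1, h2, hneg m, pneg]
    unfold aIdx
    split_ifs <;> first | (exfalso; omega) | ring
  · simp [pseq, ppos, pneg, aIdx]
  · obtain ⟨m, rfl⟩ : ∃ m : ℕ, n = m := ⟨n.toNat, by omega⟩
    have hpos : ∀ l : ℕ, pseq a1 a2 k1 k2 (l : ℤ) = ppos a1 a2 k1 k2 l := by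
      intro l
      simp [pseq]
    have h2 := hpos (m + 2)
    have h1 := hpos (m + 1)
    push_cast at h1 h2
    rw [h1, h2, hpos m, ppos]
    unfold aIdx
    split_ifs <;> first | (exfalso; omega) | ring

theorem chain_of_nonpos (a1 a2 c : ℤ) (t : ℕ → ℤ) (m : ℕ) {k : ℤ} (hk : k ≤ 0) :
    chain a1 a2 c t m k = 0 := by
  induction m with
  | zero => rfl
  | succ m ih =>
    rw [chain, bump, ih, profile_of_le_one _ _ _ _ _ (by omega),
      profile_of_le_one _ _ _ _ _ (by omega)]
    ring

theorem starPChain_chain {a1 a2 : ℤ} {X : ℤ → ℤ} {N : ℕ} {t : ℕ → ℤ}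
    (ht : ∀ m < N, t m = X (N - m))
    (hfin : ∀ m, (chain a1 a2 N t m).support.Finite)
    (hstep : ∀ m : ℕ,
      StepP a1 a2 (N - m) (t m) (chain a1 a2 N t m) (chain a1 a2 N t (m + 1))) :
    ∀ n m : ℕ, n + m = N → starPChain a1 a2 X n (chain a1 a2 N t m) = chain a1 a2 N t N := by
  intro n
  induction n with
  | zero =>
    intro m hm
    obtain rfl : m = N := by omega
    rfl
  | succ n ih =>
    intro m hm
    have h := (hstep m).fPiter_eq (hfin m)
    rw [ht m (by omega), show (N : ℤ) - m = n + 1 by omega] at h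
    rw [starPChain, h]
    exact ih (m + 1) (by omega)

theorem wtOf_chain {a1 a2 : ℤ} {X : ℤ → ℤ} {N : ℕ} {t : ℕ → ℤ}
    (hX : ∀ k, (N : ℤ) < k → X k = 0) (hX0 : ∀ k, 0 ≤ X k)
    (hfin : ∀ m, (chain a1 a2 N t m).support.Finite)
    (hstep : ∀ m : ℕ,
      StepP a1 a2 (N - m) (t m) (chain a1 a2 N t m) (chain a1 a2 N t (m + 1)))
    (m : ℕ) (ht : ∀ l < m, t l = X (N - l)) :
    wtOf a1 a2 (chain a1 a2 N t m) = wtOf a1 a2 fun k => if (N : ℤ) - m < k then X k else 0 := by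
  induction m with
  | zero =>
    congr 1
    funext k
    split_ifs with h
    · rw [hX k (by simpa using h)]
      rfl
    · rfl
  | succ m ih =>
    obtain ⟨S, hS, -, -, hb⟩ := hstep m
    have hprof : IsProfile (N - m) (X (N - m)) fun k => if k ≤ (N : ℤ) - m then X (N - m) else 0 := by
      refine ⟨⟨N - m, fun k hk => if_pos hk⟩, ⟨N - m + 1, fun k hk => if_neg (by omega)⟩,
        fun k => ?_, fun k hk => ?_⟩
      · split_ifs <;> first | exact le_rfl | exact hX0 _ | omega
      · split_ifs <;> first | rfl | omega
    have htail : (fun k => if (N : ℤ) - ((m + 1 : ℕ) : ℤ) < k then X k else 0) =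
        bump (fun k => if (N : ℤ) - m < k then X k else 0)
          fun k => if k ≤ (N : ℤ) - m then X (N - m) else 0 := by
      funext k
      unfold bump
      push_cast
      rcases lt_trichotomy k (N - m) with h | rfl | h
      · rw [if_neg (by omega), if_neg (by omega), if_pos (by omega), if_pos (by omega)]
        ring
      · rw [if_pos (by omega), if_neg (by omega), if_pos (by omega), if_neg (by omega)]
        ring
      · rw [if_pos (by omega), if_pos (by omega), if_neg (by omega), if_neg (by omega)]
        ring
    have hfin' : (Function.support fun k => if (N : ℤ) - m < k then X k else 0).Finite := by
      refine (Set.finite_Icc ((N : ℤ) - m) N).subset fun k hk => ?_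
      simp only [Function.mem_support, ne_eq, ite_eq_right_iff, not_forall] at hk
      obtain ⟨h1, h2⟩ := hk
      refine ⟨h1.le, ?_⟩
      by_contra h3
      exact h2 (hX k (not_le.mp h3))
    rw [htail, wtOf_bump a1 a2 hprof hfin', hb, wtOf_bump a1 a2 hS (hfin m),
      ih fun l hl => ht l (by omega), ht m (by omega)]

theorem starM_zero (a1 a2 : ℤ) : starM a1 a2 (fun _ => 0) = fun _ => 0 := by
  have h : ∀ n, starMChain a1 a2 (fun _ => 0) n (fun _ => 0) = fun _ => 0 := by
    intro n
    induction n with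
    | zero => rfl
    | succ n ih => simpa [starMChain, eMiter] using ih
  exact h _

/-- The weights along a sequence of steps are determined by the weight at `0`. -/
theorem pairW_of_step {a1 a2 : ℤ} {p : ℤ → ℤ} {ν : ℤ → ℤ × ℤ}
    (hrec : ∀ n, p n + p (n + 2) = aIdx a1 a2 n * p (n + 1))
    (hν : ∀ n, ν (n - 1) = ν n - p n • alphaOf a1 a2 n)
    (h0 : pairW (ν 0) (idx 0) = p 0) (h1 : pairW (ν 0) (idx 1) = -p 1) (n : ℤ) :
    pairW (ν n) (idx n) = p n ∧ pairW (ν n) (idx (n + 1)) = -p (n + 1) := by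
  have hsame : ∀ n, pairW (ν (n - 1)) (idx n) = pairW (ν n) (idx n) - 2 * p n := by
    intro n
    rw [hν n, pairW_sub_smul, pairW_alphaOf_same a1 a2 rfl]
    ring
  have hother : ∀ n k, k % 2 ≠ n % 2 →
      pairW (ν (n - 1)) (idx k) = pairW (ν n) (idx k) + aIdx a1 a2 k * p n := by
    intro n k hk
    rw [hν n, pairW_sub_smul, pairW_alphaOf_other a1 a2 (by omega)]
    ring
  induction n using Int.induction_on with
  | zero => exact ⟨h0, h1⟩
  | succ n ih =>
    obtain ⟨ih0, ih1⟩ := ih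
    have hs := hsame (n + 1)
    have ho := hother (n + 1) n (by omega)
    have hr := hrec n
    rw [add_sub_cancel_right] at hs ho
    rw [idx_eq_idx_iff.mpr (show ((n : ℤ) + 1 + 1) % 2 = n % 2 by omega), add_assoc,
      one_add_one_eq_two]
    constructor <;> linarith
  | pred n ih =>
    obtain ⟨ih0, ih1⟩ := ih
    have hs := hsame (-n)
    have ho := hother (-n) (-n - 1) (by omega)
    have hr := hrec (-n - 1)
    rw [idx_eq_idx_iff.mpr (show (-(n : ℤ) + 1) % 2 = (-n - 1) % 2 by omega)] at ih1
    rw [show -(n : ℤ) - 1 + 2 = -n + 1 by ring, sub_add_cancel] at hr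
    rw [sub_add_cancel]
    constructor <;> linarith

theorem extremal_xstarFun {a1 a2 k1 k2 : ℤ} (ha1 : 1 ≤ a1) (ha2 : 1 ≤ a2) (ha : 4 < a1 * a2)
    {x : ℤ → ℤ} (hx : SigmaPrimeMem a1 a2 k1 k2 x) :
    Extremal a1 a2 (mustar a1 a2 (lamW k1 k2) x) (xstarFun a1 a2 x) := by
  obtain ⟨⟨⟨hZ, -⟩, hc1, -, hc3, hc4, hc5, hc6, -, hc8⟩, hx0, -⟩ := hx
  obtain ⟨-, hxnn, hbd⟩ := hZ
  set X := posPart x with hX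
  have hXpos : ∀ k, 1 ≤ k → X k = x k := fun k hk => if_pos hk
  have hXneg : ∀ k, k ≤ 0 → X k = 0 := fun k hk => if_neg (by omega)
  set N := suppBoundP X with hN
  have hXN : ∀ k : ℤ, (N : ℤ) < k → X k = 0 := Nat.sInf_mem hbd
  set p := pseq a1 a2 k1 k2 with hpdef
  have hxp : ∀ k, 1 ≤ k → x k ≤ p k := fun k hk => by
    have := hc3 k hk
    exact_mod_cast sub_nonneg.mp this
  have hp : ∀ k, 0 ≤ p k := by
    intro k
    rcases lt_or_ge k 1 with hk | hk
    · have := hc6 k (by omega)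
      rw [hx0 k (by omega), Int.cast_zero, add_zero] at this
      exact_mod_cast this
    · have := hxnn k
      rw [hXpos k hk] at this
      exact this.trans (hxp k hk)
  obtain ⟨t, htdef⟩ : ∃ t : ℤ → ℤ, ∀ k, t k = if 1 ≤ k then x k else p k := ⟨_, fun _ => rfl⟩
  have htpos : ∀ k, 1 ≤ k → t k = x k := fun k hk => by rw [htdef, if_pos hk]
  have htneg : ∀ k, k ≤ 0 → t k = p k := fun k hk => by rw [htdef, if_neg (by omega)]
  have ht0 : ∀ k, 0 ≤ t k := by
    intro k
    rcases lt_or_ge k 1 with hk | hk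
    · rw [htneg k (by omega)]
      exact hp k
    · rw [htpos k hk, ← hXpos k hk]
      exact hxnn k
  have htN : ∀ k : ℤ, (N : ℤ) < k → t k = 0 := fun k hk => by
    rw [htpos k (by omega), ← hXpos k (by omega), hXN k hk]
  have hu0 : ∀ k, 0 ≤ p k - t k := by
    intro k
    rcases lt_or_ge k 1 with hk | hk
    · rw [htneg k (by omega), sub_self]
    · rw [htpos k hk]
      exact sub_nonneg.mpr (hxp k hk)
  have ht : ∀ k, (t (k + 1) : ℝ) ≤ gammaR a1 a2 k * t k := by
    intro k
    rcases lt_trichotomy k 0 with hk | rfl | hk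
    · have := hc8 (k + 1) (by omega)
      rw [add_sub_cancel_right, hx0 k hk.le, hx0 (k + 1) (by omega)] at this
      rw [htneg k hk.le, htneg (k + 1) (by omega)]
      push_cast at this
      linarith
    · rw [hx0 0 le_rfl] at hc1
      rw [htneg 0 le_rfl, htpos (0 + 1) (by omega), zero_add]
      push_cast at hc1
      linarith
    · have := hc4 k (by omega)
      rw [htpos k (by omega), htpos (k + 1) (by omega)]
      linarith
  have hu : ∀ m : ℕ, ((p (m + 1) - t (m + 1) : ℤ) : ℝ) ≤
      gammaR a2 a1 (0 - m - 1) * ((p ((m + 1 : ℕ) + 1) - t ((m + 1 : ℕ) + 1) : ℤ) : ℝ) := by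
    intro m
    have := hc5 (m + 1) (by omega)
    rw [gammaR_swap a1 a2 (show (0 - (m : ℤ) - 1) % 2 ≠ ((m : ℤ) + 1 + 1) % 2 by omega)]
    push_cast
    rw [htpos (m + 1) (by omega), htpos (m + 1 + 1) (by omega)]
    linarith
  have htm : ∀ m : ℕ, (t (N - m) : ℝ) ≤ gammaR a1 a2 (N - m - 1) * t (N - (m + 1 : ℕ)) := by
    intro m
    have := ht (N - m - 1)
    rw [sub_add_cancel] at this
    rwa [Nat.cast_succ, ← sub_sub]
  have hfinY := fun m => (chain_invariant (t := fun m => t (N - m)) ha1 ha2 ha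
    (fun m => ht0 _) htm m).1
  have hstepY := stepP_chain (t := fun m => t (N - m)) ha1 ha2 ha (fun m => ht0 _) htm
  have ha' : 4 < a2 * a1 := by rwa [mul_comm]
  have hfinV := fun m => (chain_invariant (t := fun m => p (m + 1) - t (m + 1)) ha2 ha1 ha'
    (fun m => hu0 _) hu m).1
  have hstepV := stepP_chain (t := fun m => p (m + 1) - t (m + 1)) ha2 ha1 ha' (fun m => hu0 _) hu
  have hwtY := wtOf_chain hXN hxnn hfinY hstepY N fun l hl => by
    rw [htpos _ (by omega), hXpos _ (by omega)]
  have hstar : starP a1 a2 X = chain a1 a2 N (fun m => t (N - m)) N :=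
    starPChain_chain (fun m hm => by rw [htpos _ (by omega), hXpos _ (by omega)])
      hfinY hstepY N 0 rfl
  set Y : ℤ → ℤ → ℤ := fun n => chain a1 a2 N (fun m => t (N - m)) (N - n).toNat with hY
  set V : ℤ → ℤ → ℤ := fun n => chain a2 a1 0 (fun m => p (m + 1) - t (m + 1)) n.toNat with hV
  have hYs : ∀ n, StepP a1 a2 n (t n) (Y n) (Y (n - 1)) := by
    intro n
    rcases lt_or_ge (N : ℤ) n with h | h
    · have h1 : ((N : ℤ) - n).toNat = 0 := by omega
      have h2 : ((N : ℤ) - (n - 1)).toNat = 0 := by omega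
      simp only [hY, h1, h2, htN n h]
      exact stepP_zero a1 a2 n
    · have h2 : ((N : ℤ) - (n - 1)).toNat = ((N : ℤ) - n).toNat + 1 := by omega
      have := hstepY ((N : ℤ) - n).toNat
      rw [show (N : ℤ) - ((N : ℤ) - n).toNat = n by omega] at this
      simpa only [hY, h2] using this
  have hVs : ∀ n, StepP a2 a1 (1 - n) (p n - t n) (V (n - 1)) (V n) := by
    intro n
    rcases lt_or_ge n 1 with h | h
    · have h1 : n.toNat = 0 := by omega
      have h2 : (n - 1).toNat = 0 := by omega
      simp only [hV, h1, h2, htneg n (by omega), sub_self]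
      exact stepP_zero a2 a1 (1 - n)
    · have h2 : n.toNat = (n - 1).toNat + 1 := by omega
      have := hstepV (n - 1).toNat
      rw [show 0 - ((n - 1).toNat : ℤ) = 1 - n by omega,
        show ((n - 1).toNat : ℤ) + 1 = n by omega] at this
      simpa only [hV, h2] using this
  set b : ℤ → ℤ → ℤ := fun n => combine (Y n) (mirror (V n)) with hb
  have hbfin : ∀ n, (b n).support.Finite := fun n =>
    finite_support_combine (hfinY _) (finite_support_mirror (hfinV _))
  have hneg0 : negPart x = fun _ => 0 := by
    funext k
    unfold negPart
    split_ifs with h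
    · exact hx0 k h
    · rfl
  have hb0 : b 0 = combine (chain a1 a2 N (fun m => t (N - m)) N) fun _ => 0 := by
    simp only [hb, hY, hV, sub_zero, Int.toNat_natCast, Int.toNat_zero]
    congr 1
  have hb0star : xstarFun a1 a2 x = b 0 := by
    rw [xstarFun, hneg0, starM_zero, ← hX, hstar, hb0]
  have hwt0 : wtOf a1 a2 (b 0) = wtOf a1 a2 X := by
    have h1 : b 0 = chain a1 a2 N (fun m => t (N - m)) N := by
      rw [hb0]
      funext k
      unfold combine
      split_ifs with h
      · rfl
      · rw [chain_of_nonpos _ _ _ _ _ (by omega)]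
    rw [h1, hwtY]
    congr 1
    funext k
    split_ifs with h
    · rfl
    · rw [hXneg k (by omega)]
  set μ := mustar a1 a2 (lamW k1 k2) x with hμ
  have hwtZ0 : wtZ a1 a2 μ (b 0) = -lamW k1 k2 := by
    rw [wtZ, hwt0, hμ, mustar, hneg0, ← hX]
    have : wtOf a1 a2 (fun _ => 0) = 0 := by simp [wtOf]
    rw [this]
    ring
  choose S hS hbump hSσ using fun n => exists_profile_combine μ (hYs n) (hVs n) (hfinV _)
  simp only [add_sub_cancel] at hS hSσ
  have hwt := pairW_of_step (a1 := a1) (a2 := a2) (p := p) (ν := fun n => wtZ a1 a2 μ (b n))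
    (pseq_recurrence a1 a2 k1 k2)
    (fun n => by
      rw [← wtZ_bump a1 a2 μ (hS n) (hbfin n)]
      exact congrArg _ (hbump n))
    (by
      rw [hwtZ0]
      simp [pairW, idx, lamW, hpdef, pseq, ppos])
    (by
      rw [hwtZ0]
      simp [pairW, idx, lamW, hpdef, pseq, ppos])
  rw [hb0star]
  exact extremal_of_stepZ hp hbfin (fun n => ⟨S n, hS n, hSσ n (hwt n).1, hbump n⟩)
    (fun n => (hwt n).1) (fun n => (hwt n).2) 0

end HypCrystal

open HypCrystal in
theorem sigmaPrime_star_extremal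
    (a1 a2 : ℤ) (ha1 : 1 ≤ a1) (ha2 : 1 ≤ a2) (ha : 4 < a1 * a2)
    (k1 k2 : ℤ) (hk1 : 0 < k1) (hk2 : 0 < k2)
    (hreg : 2 ≤ a1 → 2 ≤ a2 →
      (k2 ≤ k1 ∧ k1 < (a1 - 1) * k2) ∨ (k1 < k2 ∧ k2 ≤ (a2 - 1) * k1))
    (hdeg1 : a1 = 1 → 2 * k1 ≤ k2 ∧ k2 ≤ (a2 - 2) * k1)
    (hdeg2 : a2 = 1 → 2 * k2 ≤ k1 ∧ k1 ≤ (a1 - 2) * k2)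
    (x : ℤ → ℤ) (hx : SigmaPrimeMem a1 a2 k1 k2 x) :
    Extremal a1 a2 (mustar a1 a2 (lamW k1 k2) x) (xstarFun a1 a2 x) := by
  exact extremal_xstarFun ha1 ha2 ha hx
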